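/- arXiv:1808.03593 — 2 statements merged into one kernel-verified Lean document; each statement's English description precedes it below -/
import Mathlib

section
/- Let p be an odd prime and K a finite field extension of ℚ_p. For every integer m ≥ 3 and every nondegenerate quadratic form Q over K whose degree is congruent to m modulo 2, there exists a nondegenerate quadratic form of degree m over K that is Witt equivalent to Q. -/
/-- A quadratic form of degree `m` over `K`: a quadratic form on `Fin m → K`. -/
abbrev QF (K : Type) [Field K] (m : ℕ) : Type := QuadraticForm K (Fin m → K)

/-- Two quadratic forms are isometric if there is a linear equivalence of the underlying
spaces carrying one to the other. -/
def QIsom {K : Type} [Field K] {M M' : Type} [AddCommGroup M] [Module K M]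
    [AddCommGroup M'] [Module K M'] (Q : QuadraticForm K M) (Q' : QuadraticForm K M') : Prop :=
  ∃ φ : M ≃ₗ[K] M', ∀ x, Q' (φ x) = Q x

/-- The hyperbolic plane `(x, y) ↦ x * y` on `K²`. -/
noncomputable def HypForm (K : Type) [Field K] : QuadraticForm K (K × K) :=
  QuadraticMap.linMulLin (LinearMap.fst K K K) (LinearMap.snd K K K)

/-- Orthogonal sum of `m` copies of the hyperbolic plane. -/
noncomputable def HypSum (K : Type) [Field K] (m : ℕ) : QuadraticForm K (Fin m → K × K) :=
  QuadraticMap.pi (fun _ : Fin m => HypForm K)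

/-- Witt equivalence of quadratic forms. -/
def WittEquiv {K : Type} [Field K] {M M' : Type} [AddCommGroup M] [Module K M]
    [AddCommGroup M'] [Module K M'] (Q : QuadraticForm K M) (Q' : QuadraticForm K M') : Prop :=
  ∃ a b : ℕ, QIsom (Q.prod (HypSum K a)) (Q'.prod (HypSum K b))

/-- A quadratic form is nondegenerate if its polar bilinear form is nondegenerate. -/
def QNondeg {K : Type} [Field K] {M : Type} [AddCommGroup M] [Module K M]
    (Q : QuadraticForm K M) : Prop :=
  ∀ v, (∀ w, QuadraticMap.polar (⇑Q) v w = 0) → v = 0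

/-- The diagonal quadratic form `⟨a₁, …, a_m⟩`. -/
noncomputable def diagQF {K : Type} [Field K] {m : ℕ} (r : Fin m → Kˣ) : QF K m :=
  QuadraticMap.weightedSumSquares K (fun i => (r i : K))

/-- The Lie algebra `so(Q)`. -/
def soSet {K : Type} [Field K] {M : Type} [AddCommGroup M] [Module K M]
    (Q : QuadraticForm K M) : Set (Module.End K M) :=
  {X | ∀ v w, QuadraticMap.polar (⇑Q) (X v) w + QuadraticMap.polar (⇑Q) v (X w) = 0}

/-- Membership in the orthogonal group `O(Q)` (as invertible linear maps preserving `Q`). -/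
def InO {K : Type} [Field K] {M : Type} [AddCommGroup M] [Module K M]
    (Q : QuadraticForm K M) (g : M ≃ₗ[K] M) : Prop :=
  ∀ v, Q (g v) = Q v

/-- Membership in the special orthogonal group `SO(Q)`. -/
def InSO {K : Type} [Field K] {M : Type} [AddCommGroup M] [Module K M]
    (Q : QuadraticForm K M) (g : M ≃ₗ[K] M) : Prop :=
  InO Q g ∧ LinearMap.det (g : M →ₗ[K] M) = 1

/-- A nilpotent endomorphism has Jordan type `λ` when `dim ker (X^i) = Σ_j min(i, λ_j)`. -/
def HasJordanType {K : Type} [Field K] {M : Type} [AddCommGroup M] [Module K M]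
    {n : ℕ} (X : Module.End K M) (lam : Nat.Partition n) : Prop :=
  ∀ i : ℕ, Module.finrank K (LinearMap.ker (X ^ i)) = (lam.parts.map (fun part => min i part)).sum

/-- `Λ(n)`: partitions of `n` in which every even part has even multiplicity. -/
def LambdaSet (n : ℕ) : Set (Nat.Partition n) :=
  {lam | ∀ j : ℕ, Even j → Even (lam.parts.count j)}



section LocalPart
set_option linter.unusedSectionVars false

variable {L : Type} [NontriviallyNormedField L] [IsUltrametricDist L] [ProperSpace L]

lemma lp_sqrt (h2 : ‖(2 : L)‖ = 1) (a : L) (ha : ‖a - 1‖ < 1) : ∃ z : L, z * z = a := by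
  have h20 : (2 : L) ≠ 0 := by intro h; simp [h] at h2
  set r : NNReal := ‖a - 1‖₊ with hr
  have hr' : (r : ℝ) = ‖a - 1‖ := rfl
  let f : L → L := fun y => y - (y * y - a) / 2
  let s : Set L := Metric.closedBall 1 r
  have key : ∀ y ∈ s, ∀ z ∈ s, ‖f y - f z‖ ≤ r * ‖y - z‖ := by
    intro y hy z hz
    have e : f y - f z = (y - z) * (-((y - 1) + (z - 1))) / 2 := by
      simp only [f]; field_simp; ring
    rw [e, norm_div, h2, norm_mul, norm_neg, div_one, mul_comm]
    gcongr
    refine (IsUltrametricDist.norm_add_le_max _ _).trans (max_le ?_ ?_)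
    · simpa [s, dist_eq_norm] using hy
    · simpa [s, dist_eq_norm] using hz
  have h1 : (1 : L) ∈ s := by simp [s]
  have f1 : ‖f 1 - 1‖ ≤ r := by
    have : f 1 - 1 = (a - 1) / 2 := by simp only [f]; ring
    rw [this, norm_div, h2, div_one, hr']
  have hsf : Set.MapsTo f s s := by
    intro y hy
    have hy' : ‖y - 1‖ ≤ r := by simpa [s, dist_eq_norm] using hy
    have := key y hy 1 h1
    have e : f y - 1 = (f y - f 1) + (f 1 - 1) := by ring
    simp only [s, Metric.mem_closedBall, dist_eq_norm]
    rw [e]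
    refine (IsUltrametricDist.norm_add_le_max _ _).trans (max_le ?_ f1)
    refine this.trans ?_
    have : (r : ℝ) * ‖y - 1‖ ≤ 1 * r := by
      gcongr
      rw [hr']; exact ha.le
    simpa using this
  have hc : ContractingWith r (hsf.restrict f s s) := by
    refine ⟨by exact_mod_cast (hr' ▸ ha : (r : ℝ) < 1), LipschitzWith.of_dist_le_mul ?_⟩
    rintro ⟨y, hy⟩ ⟨z, hz⟩
    simpa [Subtype.dist_eq, dist_eq_norm] using key y hy z hz
  obtain ⟨z, -, hz, -⟩ := hc.exists_fixedPoint' (Metric.isClosed_closedBall.isComplete) hsf h1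
    (edist_ne_top _ _)
  refine ⟨z, ?_⟩
  have : z - (z * z - a) / 2 = z := hz
  field_simp at this
  linear_combination -this

lemma lp_mem (x : (NormedField.valuation (K := L)).valuationSubring) :
    x ∈ IsLocalRing.maximalIdeal (NormedField.valuation (K := L)).valuationSubring ↔ ‖(x : L)‖ < 1 := by
  rw [Valuation.mem_maximalIdeal_iff]
  simp [← NNReal.coe_lt_coe]

lemma lp_finite : Finite (IsLocalRing.ResidueField (NormedField.valuation (K := L)).valuationSubring) := by
  set O := (NormedField.valuation (K := L)).valuationSubring
  have hO : ∀ x : L, x ∈ O ↔ ‖x‖ ≤ 1 := fun x => by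
    simp [O, Valuation.mem_valuationSubring_iff, ← NNReal.coe_le_coe]
  obtain ⟨t, ht, hcov⟩ := Metric.totallyBounded_iff.1 (isCompact_closedBall (0:L) 1).totallyBounded 1 one_pos
  have : ∀ r : IsLocalRing.ResidueField O, ∃ y : t, ∃ x : O, IsLocalRing.residue O x = r ∧ dist (x : L) y < 1 := by
    intro r
    obtain ⟨x, rfl⟩ := IsLocalRing.residue_surjective r
    have hx : (x : L) ∈ Metric.closedBall (0 : L) 1 := by
      simpa using (hO _).1 x.2
    obtain ⟨y, hy, hxy⟩ := Set.mem_iUnion₂.1 (hcov hx)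
    exact ⟨⟨y, hy⟩, x, rfl, hxy⟩
  choose g x hx hd using this
  have := ht.to_subtype
  refine Finite.of_injective g ?_
  intro a b hab
  rw [← hx a, ← hx b, ← sub_eq_zero, ← map_sub, IsLocalRing.residue_eq_zero_iff,
    lp_mem]
  have e : ((x a - x b : O) : L) = ((x a : L) - g a) + ((g a : L) - x b) := by push_cast; ring
  rw [e]
  refine (IsUltrametricDist.norm_add_le_max _ _).trans_lt (max_lt ?_ ?_)
  · simpa [dist_eq_norm] using hd a
  · rw [hab]; simpa [dist_eq_norm, norm_sub_rev] using hd b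

lemma lp_three (h2 : ‖(2 : L)‖ = 1) (u v : L) (hu : ‖u‖ = 1) (hv : ‖v‖ = 1) :
    ∃ x y z : L, z ≠ 0 ∧ u * (x * x) + v * (y * y) + z * z = 0 := by
  have hfin := lp_finite (L := L)
  set O := (NormedField.valuation (K := L)).valuationSubring with hOdef
  have hO : ∀ x : L, x ∈ O ↔ ‖x‖ ≤ 1 := fun x => by
    simp [O, Valuation.mem_valuationSubring_iff, ← NNReal.coe_le_coe]
  let U : O := ⟨u, (hO u).2 hu.le⟩
  let V : O := ⟨v, (hO v).2 hv.le⟩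
  have hres : ∀ x : O, ‖(x : L)‖ = 1 → IsLocalRing.residue O x ≠ 0 := by
    intro x hx h
    rw [IsLocalRing.residue_eq_zero_iff, lp_mem] at h
    exact h.ne hx
  let k := IsLocalRing.ResidueField O
  have : Fintype k := Fintype.ofFinite k
  have hchar : ringChar k ≠ 2 := by
    intro h
    have h2' : ((2 : ℕ) : k) = 0 := by rw [← h]; exact ringChar.Nat.cast_ringChar
    refine hres 2 h2 ?_
    rw [map_ofNat]; exact_mod_cast h2'
  obtain ⟨x', y', hxy⟩ := FiniteField.exists_root_sum_quadratic (R := k)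
    (f := Polynomial.C (IsLocalRing.residue O U) * Polynomial.X ^ 2 + Polynomial.C 0 * Polynomial.X
      + Polynomial.C 1)
    (g := Polynomial.C (IsLocalRing.residue O V) * Polynomial.X ^ 2 + Polynomial.C 0 * Polynomial.X
      + Polynomial.C 0)
    (Polynomial.degree_quadratic (hres U hu)) (Polynomial.degree_quadratic (hres V hv))
    (FiniteField.odd_card_of_char_ne_two hchar)
  obtain ⟨x, rfl⟩ := IsLocalRing.residue_surjective x'
  obtain ⟨y, rfl⟩ := IsLocalRing.residue_surjective y'
  have hm : U * x ^ 2 + 1 + V * y ^ 2 ∈ IsLocalRing.maximalIdeal O := by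
    rw [← IsLocalRing.residue_eq_zero_iff]
    simpa using hxy
  rw [lp_mem] at hm
  have hm' : ‖-(u * ((x : L) * x) + v * ((y : L) * y)) - 1‖ < 1 := by
    rw [← norm_neg]
    refine lt_of_eq_of_lt ?_ hm
    congr 1
    simp only [U, V]; push_cast; ring
  obtain ⟨z, hz⟩ := lp_sqrt h2 _ hm'
  refine ⟨x, y, z, ?_, by rw [hz]; ring⟩
  rintro rfl
  rw [← hz] at hm'
  simp at hm'

lemma lp_unif : ∃ π : L, π ≠ 0 ∧ ‖π‖ < 1 ∧ ∀ x : L, ‖x‖ < 1 → ‖x‖ ≤ ‖π‖ := by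
  have hc : IsCompact (Metric.ball (0:L) 1) :=
    (isCompact_closedBall (0:L) 1).of_isClosed_subset (IsUltrametricDist.isClosed_ball _ _)
      Metric.ball_subset_closedBall
  obtain ⟨π, hπ, hm⟩ := hc.exists_isMaxOn ⟨0, by simp⟩ continuous_norm.continuousOn
  obtain ⟨x, hx0, hx1⟩ := NormedField.exists_norm_lt_one L
  have h : ∀ x : L, ‖x‖ < 1 → ‖x‖ ≤ ‖π‖ := fun x hx => hm (by simpa using hx)
  refine ⟨π, ?_, by simpa using hπ, h⟩
  exact norm_pos_iff.1 (hx0.trans_le (h x hx1))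

lemma lp_norm {π : L} (h0 : π ≠ 0) (h1 : ‖π‖ < 1) (hm : ∀ x : L, ‖x‖ < 1 → ‖x‖ ≤ ‖π‖)
    (x : L) (hx : x ≠ 0) : ∃ (e : Bool) (s : L), s ≠ 0 ∧ ‖x * (s * s)‖ = if e then 1 else ‖π‖ := by
  have hp : 0 < ‖π‖ := norm_pos_iff.2 h0
  obtain ⟨n, hn1, hn2⟩ := exists_mem_Ioc_zpow (norm_pos_iff.2 hx) ((one_lt_inv₀ hp).2 h1)
  have hn : ‖x * π ^ (n + 1)‖ = 1 := by
    have hq : 0 < ‖π‖ ^ (n + 1) := zpow_pos hp _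
    have hq' : 0 < ‖π‖ ^ n := zpow_pos hp _
    rw [inv_zpow, inv_lt_iff_one_lt_mul₀ hq'] at hn1
    rw [inv_zpow, le_inv_comm₀ (norm_pos_iff.2 hx) hq, ← one_div, le_div_iff₀ (norm_pos_iff.2 hx)] at hn2
    rw [mul_comm, norm_mul, norm_zpow]
    refine le_antisymm hn2 (not_lt.1 fun hlt => ?_)
    have := hm (π ^ (n + 1) * x) (by rwa [norm_mul, norm_zpow])
    rw [norm_mul, norm_zpow, zpow_add_one₀ hp.ne'] at this
    nlinarith
  obtain ⟨k, hk | hk⟩ := Int.even_or_odd' (n + 1)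
  · refine ⟨true, π ^ k, zpow_ne_zero _ h0, ?_⟩
    rw [← zpow_add₀ h0, ← two_mul, ← hk, hn]; simp
  · refine ⟨false, π ^ (k + 1), zpow_ne_zero _ h0, ?_⟩
    rw [← zpow_add₀ h0, show k + 1 + (k + 1) = (n + 1) + 1 by omega, zpow_add_one₀ h0, ← mul_assoc,
      norm_mul, hn]; simp

lemma lp_iso (h2 : ‖(2 : L)‖ = 1) {k : ℕ} (hk : 5 ≤ k) (a : Fin k → Lˣ) :
    ∃ x : Fin k → L, x ≠ 0 ∧ ∑ i, (a i : L) * (x i * x i) = 0 := by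
  obtain ⟨π, h0, h1, hm⟩ := lp_unif (L := L)
  have := fun i => lp_norm h0 h1 hm (a i : L) (a i).ne_zero
  choose e s hs hes using this
  obtain ⟨b, hb⟩ := Fintype.exists_lt_card_fiber_of_mul_lt_card (f := e) (n := 2) (by simp; omega)
  obtain ⟨i, hi, j, hj, l, hl, hij, hil, hjl⟩ := Finset.two_lt_card.1 hb
  simp only [Finset.mem_filter, Finset.mem_univ, true_and] at hi hj hl
  set A := fun i => (a i : L) * (s i * s i) with hA
  have hA0 : ∀ i, A i ≠ 0 := fun i => mul_ne_zero (a i).ne_zero (mul_ne_zero (hs i) (hs i))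
  have hn1 : ‖A i / A l‖ = 1 := by
    rw [norm_div, div_eq_one_iff_eq (norm_ne_zero_iff.2 (hA0 l)), hA]; simp only
    rw [hes, hes, hi, hl]
  have hn2 : ‖A j / A l‖ = 1 := by
    rw [norm_div, div_eq_one_iff_eq (norm_ne_zero_iff.2 (hA0 l)), hA]; simp only
    rw [hes, hes, hj, hl]
  obtain ⟨x, y, z, hz, h⟩ := lp_three h2 _ _ hn1 hn2
  have hAl := hA0 l
  field_simp at h
  refine ⟨Pi.single i (s i * x) + Pi.single j (s j * y) + Pi.single l (s l * z), ?_, ?_⟩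
  · intro hh
    have := congrFun hh l
    simp [hil.symm, hjl.symm, hz, hs] at this
  · have hsum : ∀ m, (a m : L) * ((Pi.single i (s i * x) + Pi.single j (s j * y) + Pi.single l (s l * z) : Fin k → L) m * (Pi.single i (s i * x) + Pi.single j (s j * y) + Pi.single l (s l * z) : Fin k → L) m)
      = Pi.single (M := fun _ => L) i (A i * (x * x)) m + Pi.single (M := fun _ => L) j (A j * (y * y)) m
        + Pi.single (M := fun _ => L) l (A l * (z * z)) m := by
      intro m
      by_cases hmi : m = i
      · subst hmi; simp [hij, hil, hA]; ring
      by_cases hmj : m = j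
      · subst hmj; simp [hjl, hmi, hA]; ring
      by_cases hml : m = l
      · subst hml; simp [hmj, hmi, hA]; ring
      simp [hmi, hmj, hml]
    rw [Finset.sum_congr rfl fun m _ => hsum m, Finset.sum_add_distrib, Finset.sum_add_distrib]
    simp only [Finset.sum_pi_single', Finset.mem_univ, if_true]
    linear_combination h
end LocalPart

lemma loc_iso (p : ℕ) [Fact p.Prime] (hp : p ≠ 2) (K : Type) [Field K]
    [Algebra ℚ_[p] K] [FiniteDimensional ℚ_[p] K] {k : ℕ} (hk : 5 ≤ k) (a : Fin k → Kˣ) :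
    ∃ x : Fin k → K, x ≠ 0 ∧ ∑ i, (a i : K) * (x i * x i) = 0 := by
  let _ : NontriviallyNormedField K := spectralNorm.nontriviallyNormedField ℚ_[p] K
  let _ : NormedSpace ℚ_[p] K := spectralNorm.normedSpace ℚ_[p] K
  have : ProperSpace K := FiniteDimensional.proper ℚ_[p] K
  have : IsUltrametricDist K := IsUltrametricDist.isUltrametricDist_of_isNonarchimedean_norm
    (isNonarchimedean_spectralNorm (K := ℚ_[p]) (L := K))
  refine lp_iso ?_ hk a
  have h : ‖algebraMap ℚ_[p] K 2‖ = ‖(2 : ℚ_[p])‖ := spectralNorm_extends _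
  rw [map_ofNat] at h
  rw [h]
  have : ‖((2 : ℕ) : ℚ_[p])‖ = 1 := by
    rw [Padic.norm_natCast_eq_one_iff]
    exact (Nat.coprime_primes Fact.out Nat.prime_two).2 hp
  exact_mod_cast this

section FormPart
variable {K : Type} [Field K] {M N P : Type} [AddCommGroup M] [Module K M]
    [AddCommGroup N] [Module K N] [AddCommGroup P] [Module K P]

lemma fp_symm {Q : QuadraticForm K M} {Q' : QuadraticForm K N} (h : QIsom Q Q') : QIsom Q' Q := by
  obtain ⟨φ, h⟩ := h
  exact ⟨φ.symm, fun x => by rw [← h, φ.apply_symm_apply]⟩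

lemma fp_trans {Q : QuadraticForm K M} {Q' : QuadraticForm K N} {Q'' : QuadraticForm K P}
    (h : QIsom Q Q') (h' : QIsom Q' Q'') : QIsom Q Q'' := by
  obtain ⟨φ, h⟩ := h
  obtain ⟨ψ, h'⟩ := h'
  exact ⟨φ.trans ψ, fun x => by simp [h, h']⟩

lemma fp_nondeg {Q : QuadraticForm K M} {Q' : QuadraticForm K N} (h : QIsom Q Q') (hQ : QNondeg Q) :
    QNondeg Q' := by
  obtain ⟨φ, h⟩ := fp_symm h
  intro v hv
  have : φ v = 0 := by
    refine hQ _ fun w => ?_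
    have := hv (φ.symm w)
    simp only [QuadraticMap.polar, ← h, map_add, φ.apply_symm_apply] at this ⊢
    exact this
  simpa using this

lemma fp_nondeg_prod {Q : QuadraticForm K M} {Q' : QuadraticForm K N} (h : QNondeg Q)
    (h' : QNondeg Q') : QNondeg (Q.prod Q') := by
  rintro ⟨v, v'⟩ hv
  have a : v = 0 := h _ fun w => by simpa using hv (w, 0)
  have b : v' = 0 := h' _ fun w => by simpa using hv (0, w)
  simp [a, b]

lemma fp_nondeg_left {Q : QuadraticForm K M} {Q' : QuadraticForm K N} (h : QNondeg (Q.prod Q')) :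
    QNondeg Q := by
  intro v hv
  have := h (v, 0) fun w => by simpa using hv w.1
  simpa using this

lemma fp_hyp : QNondeg (HypForm K) := by
  rintro ⟨a, b⟩ h
  have h1 := h (1, 0)
  have h2 := h (0, 1)
  simp [HypForm, QuadraticMap.polar] at h1 h2
  ring_nf at h1 h2
  simp [h1, h2]

lemma fp_hypsum (m : ℕ) : QNondeg (HypSum K m) := by
  intro v hv
  funext i
  refine fp_hyp _ fun w => ?_
  have := hv (Pi.single i w)
  rw [HypSum, QuadraticMap.Ring.polar_pi] at this
  rw [Finset.sum_eq_single i] at this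
  · simpa using this
  · intro j _ hj
    simp [hj]
  · simp

/-- Transport to coordinates. -/
lemma fp_coord [FiniteDimensional K M] (Q : QuadraticForm K M) {m : ℕ}
    (hm : Module.finrank K M = m) : ∃ Q' : QF K m, QIsom Q Q' := by
  let φ : M ≃ₗ[K] (Fin m → K) := LinearEquiv.ofFinrankEq _ _ (by simp [hm])
  exact ⟨Q.comp φ.symm.toLinearMap, φ, fun x => by simp⟩

/-- Splitting off a hyperbolic plane. -/
lemma fp_split [FiniteDimensional K M] (Q : QuadraticForm K M) (hQ : QNondeg Q) (v : M) (hv : v ≠ 0)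
    (hv0 : Q v = 0) : ∃ (W : Submodule K M) (Q' : QuadraticForm K W),
      QIsom Q (Q'.prod (HypForm K)) := by
  obtain ⟨w, hw⟩ : ∃ w, QuadraticMap.polar Q v w ≠ 0 := by
    by_contra! h
    exact hv (hQ v h)
  set B := Q.polarBilin with hB
  have hBp : ∀ x y, QuadraticMap.polar Q x y = B x y := fun x y => rfl
  have hadd : ∀ x y, Q (x + y) = Q x + Q y + B x y := fun x y => by
    rw [← hBp, QuadraticMap.polar]; ring
  have hBs : ∀ x y, B x y = B y x := fun x y => QuadraticMap.polar_comm _ _ _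
  have hBd : ∀ x, B x x = 2 * Q x := fun x => by
    rw [← hBp, QuadraticMap.polar_self]; simp [two_mul]
  rw [hBp] at hw
  obtain ⟨f, hf0, hf1⟩ : ∃ f, Q f = 0 ∧ B v f = 1 := by
    refine ⟨(B v w)⁻¹ • w + (-((B v w)⁻¹ * (B v w)⁻¹ * Q w)) • v, ?_, ?_⟩
    · rw [hadd, QuadraticMap.map_smul, QuadraticMap.map_smul, hv0]
      simp only [map_smul, LinearMap.smul_apply, smul_eq_mul, hBs w v]
      field_simp
      ring
    · simp only [map_add, map_smul, smul_eq_mul, hBd, hv0]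
      field_simp
      ring
  have hff : B f f = 0 := by rw [hBd, hf0, mul_zero]
  have hvv : B v v = 0 := by rw [hBd, hv0, mul_zero]
  have hf1' : B f v = 1 := by rw [hBs, hf1]
  let W : Submodule K M := LinearMap.ker (B v) ⊓ LinearMap.ker (B f)
  let φ : M →ₗ[K] M := LinearMap.id - (B f).smulRight v - (B v).smulRight f
  have hφ : ∀ x, φ x = x - B f x • v - B v x • f := fun x => by simp [φ]
  have hφW : ∀ x, φ x ∈ W := by
    intro x
    simp [W, hφ, hff, hvv, hf1, hf1']
  refine ⟨W, Q.comp W.subtype, fp_symm ⟨?_, ?_⟩⟩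
  · refine LinearEquiv.ofLinearMap
      (W.subtype.coprod ((LinearMap.fst K K K).smulRight v + (LinearMap.snd K K K).smulRight f))
      ((φ.codRestrict W hφW).prod ((B f).prod (B v))) ?_ ?_
    · ext x
      simp [hφ]
    · refine LinearMap.ext ?_
      rintro ⟨⟨x, hx⟩, a, b⟩
      have hx1 : B v x = 0 := hx.1
      have hx2 : B f x = 0 := hx.2
      refine Prod.ext (Subtype.ext ?_) (Prod.ext ?_ ?_) <;>
      simp [hφ, hff, hvv, hf1, hf1', hx1, hx2]
  · rintro ⟨⟨x, hx⟩, a, b⟩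
    have hx1 : B v x = 0 := hx.1
    have hx2 : B f x = 0 := hx.2
    simp [HypForm, hadd, QuadraticMap.map_smul, hBs x, hx1, hx2, hf0, hv0, hf1]
    ring

lemma fp_hypsucc (j : ℕ) (Q : QuadraticForm K M) :
    QIsom ((Q.prod (HypSum K j)).prod (HypForm K)) (Q.prod (HypSum K (j + 1))) := by
  refine ⟨(LinearEquiv.prodAssoc K _ _ _).trans ((LinearEquiv.refl K M).prodCongr
    ((LinearEquiv.prodComm K _ _).trans (Fin.consLinearEquiv K (fun _ : Fin (j + 1) => K × K)))), ?_⟩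
  rintro ⟨⟨x, y⟩, z⟩
  simp [HypSum, Fin.sum_univ_succ]
  ring

lemma fp_prod {Q : QuadraticForm K M} {Q' : QuadraticForm K N} (h : QIsom Q Q')
    (R : QuadraticForm K P) : QIsom (Q.prod R) (Q'.prod R) := by
  obtain ⟨φ, h⟩ := h
  exact ⟨φ.prodCongr (LinearEquiv.refl K P), by rintro ⟨x, y⟩; simp [h]⟩

lemma fp_zero (Q : QuadraticForm K M) : QIsom (Q.prod (HypSum K 0)) Q := by
  refine ⟨LinearEquiv.prodUnique (R := K) (M := M) (M₂ := Fin 0 → K × K), ?_⟩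
  rintro ⟨x, y⟩
  simp [HypSum]

end FormPart

lemma fp_isotropic (p : ℕ) [Fact p.Prime] (hp : p ≠ 2) (K : Type) [Field K]
    [Algebra ℚ_[p] K] [FiniteDimensional ℚ_[p] K] {k : ℕ} (hk : 5 ≤ k) (Q : QF K k) :
    ∃ v, v ≠ 0 ∧ Q v = 0 := by
  have : CharZero K := charZero_of_injective_algebraMap (algebraMap ℚ_[p] K).injective
  let _ : Invertible (2 : K) := invertibleOfNonzero two_ne_zero
  obtain ⟨w, ⟨φ⟩⟩ := QuadraticForm.equivalent_weightedSumSquares Q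
  suffices h : ∃ x, x ≠ 0 ∧ QuadraticMap.weightedSumSquares K w x = 0 by
    obtain ⟨x, hx, h⟩ := h
    refine ⟨φ.symm x, ?_, by rw [φ.symm.map_app, h]⟩
    intro h0
    apply hx
    have := congrArg φ h0
    rw [φ.apply_symm_apply] at this
    rw [this]; exact map_zero φ.toLinearEquiv
  by_cases hw : ∃ i, w i = 0
  · obtain ⟨i, hi⟩ := hw
    refine ⟨Pi.single i 1, by simp, ?_⟩
    rw [QuadraticMap.weightedSumSquares_apply]
    refine Finset.sum_eq_zero fun j _ => ?_
    by_cases hj : j = i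
    · subst hj; simp [hi]
    · simp [hj]
  · push Not at hw
    obtain ⟨x, hx, h⟩ := loc_iso p hp K (k := Module.finrank K (Fin k → K)) (by simpa using hk)
      (fun i => Units.mk0 (w i) (hw i))
    exact ⟨x, hx, by simpa [QuadraticMap.weightedSumSquares_apply] using h⟩

lemma fp_reduce (p : ℕ) [Fact p.Prime] (hp : p ≠ 2) (K : Type) [Field K]
    [Algebra ℚ_[p] K] [FiniteDimensional ℚ_[p] K] (m : ℕ) (hm : 3 ≤ m) (j : ℕ) :
    ∀ Q : QF K (m + 2 * j), QNondeg Q → ∃ Q' : QF K m, QNondeg Q' ∧ QIsom (Q'.prod (HypSum K j)) Q := by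
  induction j with
  | zero => exact fun Q hQ => ⟨Q, hQ, fp_zero Q⟩
  | succ j ih =>
    intro Q hQ
    obtain ⟨v, hv, hv0⟩ := fp_isotropic p hp K (by omega) Q
    obtain ⟨W, R, hR⟩ := fp_split Q hQ v hv hv0
    have hfr : Module.finrank K W = m + 2 * j := by
      have := hR.choose.finrank_eq
      simp at this
      omega
    obtain ⟨R', hR'⟩ := fp_coord R hfr
    have hQR : QIsom Q (R'.prod (HypForm K)) := fp_trans hR (fp_prod hR' _)
    obtain ⟨Q', hQ', h⟩ := ih R' (fp_nondeg_left (fp_nondeg hQR hQ))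
    exact ⟨Q', hQ', fp_trans (fp_symm (fp_hypsucc j Q')) (fp_trans (fp_prod h _) (fp_symm hQR))⟩

/-- For every `m ≥ 3` and every nondegenerate quadratic form `Q` over `K` of degree congruent
to `m` mod `2`, there is a nondegenerate form of degree `m` Witt equivalent to `Q`. -/
theorem statement_14 (p : ℕ) [Fact p.Prime] (hp : p ≠ 2) (K : Type) [Field K]
    [Algebra ℚ_[p] K] [FiniteDimensional ℚ_[p] K]
    (m : ℕ) (hm : 3 ≤ m) (k : ℕ) (Q : QF K k) (hQ : QNondeg Q) (hpar : k % 2 = m % 2) :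
    ∃ Q' : QF K m, QNondeg Q' ∧ WittEquiv Q' Q := by
  rcases le_total m k with h | h
  · obtain ⟨j, rfl⟩ : ∃ j, k = m + 2 * j := ⟨(k - m) / 2, by omega⟩
    obtain ⟨Q', hQ', h'⟩ := fp_reduce p hp K m hm j Q hQ
    exact ⟨Q', hQ', j, 0, fp_trans h' (fp_symm (fp_zero Q))⟩
  · obtain ⟨j, rfl⟩ : ∃ j, m = k + 2 * j := ⟨(m - k) / 2, by omega⟩
    obtain ⟨Q', hQ'⟩ := fp_coord (Q.prod (HypSum K j)) (m := k + 2 * j) (by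
      simp [Module.finrank_pi_fintype]; ring)
    exact ⟨Q', fp_nondeg hQ' (fp_nondeg_prod hQ (fp_hypsum j)), 0, j,
      fp_trans (fp_zero Q') (fp_symm hQ')⟩
end

section
/- Let p be an odd prime and K a finite field extension of ℚ_p. Let u and v be anisotropic quadratic forms over K, both of degree m, where m = 1 or m = 3, and suppose u and v are not isometric. Then there exists an anisotropic quadratic form of degree 2 over K that is Witt equivalent to u ⊥ (−v). -/
set_option linter.unusedSectionVars false
set_option linter.style.haveILetI false

section LocalFacts
open scoped NormedField Valued

variable {K : Type} [NontriviallyNormedField K] [IsUltrametricDist K] [ProperSpace K]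

theorem lf_norm_sub (x y : K) : ‖x - y‖ ≤ max ‖x‖ ‖y‖ := by
  rw [sub_eq_add_neg, ← norm_neg y]
  exact IsUltrametricDist.norm_add_le_max _ _

theorem lf_residue_eq_zero (x : 𝒪[K]) : IsLocalRing.residue 𝒪[K] x = 0 ↔ ‖(x : K)‖ < 1 := by
  rw [IsLocalRing.residue_eq_zero_iff, IsLocalRing.mem_maximalIdeal, mem_nonunits_iff,
    Valued.integer.isUnit_iff_norm_eq_one]
  have := Valued.integer.norm_le_one x
  constructor
  · intro h; exact lt_of_le_of_ne this h
  · intro h; exact ne_of_lt h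

theorem lf_sqrt_one_add (h2 : ‖(2 : K)‖ = 1) (t : K) (ht : ‖t‖ < 1) : ∃ z : K, z * z = 1 + t := by
  have h20 : (2 : K) ≠ 0 := by intro h; simp [h] at h2
  let f : K → K := fun z => (t - z * z) / 2
  have hmaps : Set.MapsTo f (Metric.closedBall 0 ‖t‖) (Metric.closedBall 0 ‖t‖) := by
    intro z hz
    simp only [mem_closedBall_zero_iff] at hz ⊢
    simp only [f, norm_div, h2, div_one]
    refine (lf_norm_sub _ _).trans (max_le le_rfl ?_)
    rw [norm_mul]
    nlinarith [norm_nonneg z, norm_nonneg t]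
  have hc : ContractingWith ‖t‖₊ (hmaps.restrict f _ _) := by
    refine ⟨by exact_mod_cast ht, LipschitzWith.of_dist_le_mul ?_⟩
    rintro ⟨x, hx⟩ ⟨y, hy⟩
    simp only [mem_closedBall_zero_iff] at hx hy
    change dist (f x) (f y) ≤ ‖t‖ * dist x y
    rw [dist_eq_norm, dist_eq_norm]
    have : f x - f y = (-(x + y)) * (x - y) / 2 := by simp only [f]; field_simp; ring
    rw [this, norm_div, h2, div_one, norm_mul, norm_neg]
    exact mul_le_mul_of_nonneg_right
      ((IsUltrametricDist.norm_add_le_max _ _).trans (max_le hx hy)) (norm_nonneg _)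
  obtain ⟨z, -, hz, -⟩ := hc.exists_fixedPoint' (x := (0 : K))
    (Metric.isClosed_closedBall.isComplete) hmaps (by simp) (edist_ne_top _ _)
  refine ⟨1 + z, ?_⟩
  have hz' : (t - z * z) / 2 = z := hz
  field_simp at hz'
  linear_combination -hz'

theorem lf_sq_of_residue (h2 : ‖(2 : K)‖ = 1) (x y : 𝒪[K])
    (h0 : IsLocalRing.residue 𝒪[K] x ≠ 0)
    (h : IsLocalRing.residue 𝒪[K] x = IsLocalRing.residue 𝒪[K] y * IsLocalRing.residue 𝒪[K] y) :
    ∃ z : K, z * z = x := by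
  have hy0 : IsLocalRing.residue 𝒪[K] y ≠ 0 := by
    intro hy; apply h0; rw [h, hy, mul_zero]
  have hy1 : ‖(y : K)‖ = 1 := le_antisymm (Valued.integer.norm_le_one y)
    (not_lt.mp (fun hh => hy0 ((lf_residue_eq_zero y).2 hh)))
  have hyn : (y : K) ≠ 0 := by intro hh; simp [hh] at hy1
  have hlt : ‖((x - y * y : 𝒪[K]) : K)‖ < 1 := by
    rw [← lf_residue_eq_zero, map_sub, map_mul, h, sub_self]
  obtain ⟨z, hz⟩ := lf_sqrt_one_add h2 (((x - y * y : 𝒪[K]) : K) / (y * y)) (by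
    rw [norm_div, norm_mul, hy1]; simpa using hlt)
  refine ⟨z * y, ?_⟩
  have : z * y * (z * y) = (z * z) * (y * y) := by ring
  rw [this, hz]
  push_cast
  field_simp
  ring

theorem lf_finite : Finite 𝓀[K] := by
  obtain ⟨t, -, htf, ht⟩ := (isCompact_closedBall (0 : K) 1).finite_cover_balls one_pos
  have hsurj : ∀ r : 𝓀[K], ∃ y ∈ t, ∃ x : 𝒪[K], IsLocalRing.residue 𝒪[K] x = r ∧
      ‖(x : K) - y‖ < 1 := by
    intro r
    obtain ⟨x, rfl⟩ := IsLocalRing.residue_surjective r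
    have := ht (show (x : K) ∈ Metric.closedBall 0 1 by
      simpa using Valued.integer.norm_le_one x)
    simp only [Set.mem_iUnion, Metric.mem_ball, dist_eq_norm] at this
    obtain ⟨y, hy, hxy⟩ := this
    exact ⟨y, hy, x, rfl, hxy⟩
  choose g hg x hx hxg using hsurj
  have := htf.to_subtype
  refine Finite.of_injective (fun r => (⟨g r, hg r⟩ : t)) ?_
  intro r s hrs
  have hrs : g r = g s := congrArg Subtype.val hrs
  rw [← hx r, ← hx s, ← sub_eq_zero, ← map_sub, lf_residue_eq_zero]
  have : ((x r - x s : 𝒪[K]) : K) = (x r - g r) - (x s - g s) := by push_cast; rw [hrs]; ring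
  rw [this]
  exact (lf_norm_sub _ _).trans_lt (max_lt (hxg r) (hxg s))

theorem lf_dvr : IsDiscreteValuationRing 𝒪[K] := by
  have : CompactSpace 𝒪[K] := by
    rw [← isCompact_univ_iff, Subtype.isCompact_iff]
    have : ((↑) '' (Set.univ : Set 𝒪[K]) : Set K) = Metric.closedBall 0 1 := by
      ext x; simp [Valued.integer.mem_iff]
    exact this ▸ isCompact_closedBall (0 : K) 1
  have : (Valued.v : Valuation K NNReal).IsNontrivial := by
    obtain ⟨x, hx, hx'⟩ := NormedField.exists_norm_lt_one K
    rw [Valuation.isNontrivial_iff_exists_lt_one]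
    refine ⟨x, by simpa using hx, ?_⟩
    simpa [← NNReal.coe_lt_coe] using hx'
  exact Valued.integer.isDiscreteValuationRing_of_compactSpace


/-- Elements of even valuation. -/
def lfU (x : K) : Prop := ∃ (a : 𝒪[K]) (y : K), IsLocalRing.residue 𝒪[K] a ≠ 0 ∧ y ≠ 0 ∧ x = a * (y * y)

theorem lfU_mul {x y : K} (hx : lfU x) (hy : lfU y) : lfU (x * y) := by
  obtain ⟨a, z, ha, hz, rfl⟩ := hx
  obtain ⟨b, w, hb, hw, rfl⟩ := hy
  refine ⟨a * b, z * w, ?_, mul_ne_zero hz hw, by push_cast; ring⟩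
  rw [map_mul]; exact mul_ne_zero ha hb

theorem lfU_ne {x : K} (hx : lfU x) : x ≠ 0 := by
  obtain ⟨a, z, ha, hz, rfl⟩ := hx
  refine mul_ne_zero ?_ (mul_ne_zero hz hz)
  intro h
  apply ha
  rw [lf_residue_eq_zero, h]; simp

theorem lfU_neg {x : K} (hx : lfU x) : lfU (-x) := by
  obtain ⟨a, z, ha, hz, rfl⟩ := hx
  exact ⟨-a, z, by simpa using ha, hz, by push_cast; ring⟩

theorem lf_two (h2 : ‖(2 : K)‖ = 1) : (2 : 𝓀[K]) ≠ 0 := by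
  have : (2 : 𝓀[K]) = IsLocalRing.residue 𝒪[K] 2 := (map_ofNat _ 2).symm
  rw [this, Ne, lf_residue_eq_zero]
  have h : ((2 : 𝒪[K]) : K) = 2 := rfl
  rw [h, h2]; exact lt_irrefl _

theorem lfU_index (h2 : ‖(2 : K)‖ = 1) {x y : K} (hx : lfU x) (hy : lfU y)
    (hxs : ¬ IsSquare x) (hys : ¬ IsSquare y) : IsSquare (x * y) := by
  obtain ⟨a, z, ha, hz, rfl⟩ := hx
  obtain ⟨b, w, hb, hw, rfl⟩ := hy
  have key : ∀ (a : 𝒪[K]) (z : K), IsLocalRing.residue 𝒪[K] a ≠ 0 →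
      IsSquare (IsLocalRing.residue 𝒪[K] a) → IsSquare ((a : K) * (z * z)) := by
    intro a z ha ⟨r, hr⟩
    obtain ⟨y, rfl⟩ := IsLocalRing.residue_surjective r
    obtain ⟨s, hs⟩ := lf_sq_of_residue h2 a y ha hr
    exact ⟨s * z, by rw [← hs]; ring⟩
  have hna : ¬ IsSquare (IsLocalRing.residue 𝒪[K] a) := fun h => hxs (key a z ha h)
  have hnb : ¬ IsSquare (IsLocalRing.residue 𝒪[K] b) := fun h => hys (key b w hb h)
  have := key (a * b) (z * w) (by rw [map_mul]; exact mul_ne_zero ha hb) (by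
    rw [map_mul]
    have := lf_finite (K := K)
    have := Fintype.ofFinite 𝓀[K]
    classical
    have h2' : ringChar 𝓀[K] ≠ 2 := fun h => lf_two h2 (by
      have := ringChar.Nat.cast_ringChar (R := 𝓀[K]); rw [h] at this; exact_mod_cast this)
    rw [← quadraticChar_neg_one_iff_not_isSquare] at hna hnb
    rw [← quadraticChar_one_iff_isSquare (mul_ne_zero ha hb), map_mul, hna, hnb]
    norm_num)
  convert! this using 1
  push_cast; ring

theorem lfU_repr (h2 : ‖(2 : K)‖ = 1) {x y z : K} (hx : lfU x) (hy : lfU y) (hz : lfU z) :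
    ∃ r s : K, x * (r * r) + y * (s * s) = z := by
  obtain ⟨a, u, ha, hu, rfl⟩ := hx
  obtain ⟨b, v, hb, hv, rfl⟩ := hy
  obtain ⟨c, w, hc, hw, rfl⟩ := hz
  suffices h : ∃ r s : K, (a : K) * (r * r) + b * (s * s) = c by
    obtain ⟨r, s, h⟩ := h
    refine ⟨r * w / u, s * w / v, ?_⟩
    rw [← h]; field_simp
  have aux : ∀ a b : 𝒪[K], IsLocalRing.residue 𝒪[K] a ≠ 0 → ∀ r s : 𝓀[K], r ≠ 0 →
      IsLocalRing.residue 𝒪[K] a * (r * r) + IsLocalRing.residue 𝒪[K] b * (s * s)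
        = IsLocalRing.residue 𝒪[K] c → ∃ r s : K, (a : K) * (r * r) + b * (s * s) = c := by
    intro a b ha r s hr h
    obtain ⟨r, rfl⟩ := IsLocalRing.residue_surjective r
    obtain ⟨s, rfl⟩ := IsLocalRing.residue_surjective s
    have hau : IsUnit a := by
      by_contra hh
      exact ha ((IsLocalRing.residue_eq_zero_iff a).2 hh)
    obtain ⟨a', ha'⟩ := hau.exists_right_inv
    have h1 : IsLocalRing.residue 𝒪[K] a * IsLocalRing.residue 𝒪[K] a' = 1 := by
      rw [← map_mul, ha', map_one]
    have he : IsLocalRing.residue 𝒪[K] ((c - b * (s * s)) * a') =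
        IsLocalRing.residue 𝒪[K] r * IsLocalRing.residue 𝒪[K] r := by
      simp only [map_mul, map_sub]
      rw [← h]
      linear_combination (IsLocalRing.residue 𝒪[K] r * IsLocalRing.residue 𝒪[K] r) * h1
    obtain ⟨t, ht⟩ := lf_sq_of_residue h2 ((c - b * (s * s)) * a') r
      (by rw [he]; exact mul_ne_zero hr hr) he
    refine ⟨t, s, ?_⟩
    have ha'' : (a : K) * a' = 1 := by exact_mod_cast congrArg (Subtype.val) ha'
    rw [ht]; push_cast
    linear_combination ((c : K) - b * (s * s)) * ha''
  have := lf_finite (K := K)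
  have := Fintype.ofFinite 𝓀[K]
  have h2' : ringChar 𝓀[K] ≠ 2 := fun h => lf_two h2 (by
      have := ringChar.Nat.cast_ringChar (R := 𝓀[K]); rw [h] at this; exact_mod_cast this)
  open Polynomial in
  obtain ⟨r, s, hrs⟩ := FiniteField.exists_root_sum_quadratic (R := 𝓀[K])
    (f := C (IsLocalRing.residue 𝒪[K] a) * X ^ 2 + C 0 * X + C (- IsLocalRing.residue 𝒪[K] c))
    (g := C (IsLocalRing.residue 𝒪[K] b) * X ^ 2 + C 0 * X + C 0)
    (degree_quadratic ha) (degree_quadratic hb) (FiniteField.odd_card_of_char_ne_two h2')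
  simp only [Polynomial.eval_add, Polynomial.eval_mul, Polynomial.eval_C, Polynomial.eval_pow,
    Polynomial.eval_X] at hrs
  by_cases hr : r = 0
  · have hs : s ≠ 0 := by
      rintro rfl
      apply hc
      rw [hr] at hrs
      linear_combination -hrs
    obtain ⟨s', r', h⟩ := aux b a hb s r hs (by linear_combination hrs)
    exact ⟨r', s', by rw [← h]; ring⟩
  · exact aux a b ha r s hr (by linear_combination hrs)

theorem lfU_pi : ∃ q : K, ∀ x : K, x ≠ 0 → lfU x ∨ ∃ y, lfU y ∧ x = q * y := by
  have := lf_dvr (K := K)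
  obtain ⟨ϖ, hϖ⟩ := IsDiscreteValuationRing.exists_irreducible 𝒪[K]
  have hϖ0 : (ϖ : K) ≠ 0 := by
    intro h; exact hϖ.ne_zero (Subtype.ext h)
  have hunit : ∀ u : 𝒪[K]ˣ, IsLocalRing.residue 𝒪[K] u ≠ 0 := by
    intro u hu
    exact (IsLocalRing.residue_eq_zero_iff _).1 hu u.isUnit
  have h1 : ∀ x : K, x ≠ 0 → ‖x‖ ≤ 1 → lfU x ∨ ∃ y, lfU y ∧ x = ϖ * y := by
    intro x hx hx1
    obtain ⟨n, u, hu⟩ := IsDiscreteValuationRing.eq_unit_mul_pow_irreducible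
      (x := (⟨x, Valued.integer.mem_iff.2 hx1⟩ : 𝒪[K])) (by
        intro h; exact hx (congrArg Subtype.val h)) hϖ
    have hxe : x = ((u : 𝒪[K]) : K) * (ϖ : K) ^ n := by
      have := congrArg Subtype.val hu
      simpa using this
    rcases Nat.even_or_odd' n with ⟨k, hk | hk⟩
    · left
      refine ⟨u, (ϖ : K) ^ k, hunit u, pow_ne_zero _ hϖ0, ?_⟩
      rw [hxe, hk]; ring
    · right
      refine ⟨_, ⟨u, (ϖ : K) ^ k, hunit u, pow_ne_zero _ hϖ0, rfl⟩, ?_⟩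
      rw [hxe, hk]; ring
  have hsq : ∀ x z : K, z ≠ 0 → lfU x → lfU (x * (z * z)) := by
    rintro x z hz ⟨a, y, ha, hy, rfl⟩
    exact ⟨a, y * z, ha, mul_ne_zero hy hz, by ring⟩
  refine ⟨ϖ, fun x hx => ?_⟩
  by_cases hx1 : ‖x‖ ≤ 1
  · exact h1 x hx hx1
  · rcases h1 x⁻¹ (inv_ne_zero hx) (by
      rw [norm_inv]; exact inv_le_one_of_one_le₀ (le_of_not_ge hx1)) with h | ⟨y, hy, h⟩
    · left
      have := hsq _ x hx h
      convert! this using 1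
      field_simp
    · right
      refine ⟨y * (x * x), hsq _ x hx hy, ?_⟩
      have : x * x⁻¹ = 1 := mul_inv_cancel₀ hx
      rw [h] at this
      linear_combination -x * this

end LocalFacts

theorem lf_main (p : ℕ) [Fact p.Prime] (hp : p ≠ 2) (K : Type) [Field K]
    [Algebra ℚ_[p] K] [FiniteDimensional ℚ_[p] K] :
    (2 : K) ≠ 0 ∧ ∃ (U : K → Prop) (q : K), (∀ x y, U x → U y → U (x * y)) ∧ (∀ x, U x → x ≠ 0) ∧
      (∀ x, U x → U (-x)) ∧
      (∀ x y, U x → U y → ¬ IsSquare x → ¬ IsSquare y → IsSquare (x * y)) ∧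
      (∀ x y z, U x → U y → U z → ∃ r s : K, x * (r * r) + y * (s * s) = z) ∧
      (∀ x, x ≠ 0 → U x ∨ ∃ y, U y ∧ x = q * y) := by
  letI i1 : NontriviallyNormedField K := spectralNorm.nontriviallyNormedField ℚ_[p] K
  letI i2 : NormedAlgebra ℚ_[p] K := spectralNorm.normedAlgebra ℚ_[p] K
  haveI i3 : IsUltrametricDist K :=
    IsUltrametricDist.isUltrametricDist_of_isNonarchimedean_norm
      (isNonarchimedean_spectralNorm (K := ℚ_[p]) (L := K))
  haveI i4 : ProperSpace K := FiniteDimensional.proper ℚ_[p] K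
  have h2 : ‖(2 : K)‖ = 1 := by
    have : (2 : K) = algebraMap ℚ_[p] K 2 := (map_ofNat _ 2).symm
    rw [this, norm_algebraMap']
    have h := Padic.norm_natCast_eq_one_iff (p := p) (n := 2)
    have h' : p.Coprime 2 := (Nat.coprime_primes (Fact.out) Nat.prime_two).2 hp
    exact_mod_cast h.2 h'
  refine ⟨fun h => by simp [h] at h2, lfU, ?_⟩
  obtain ⟨q, hq⟩ := lfU_pi (K := K)
  exact ⟨q, fun _ _ => lfU_mul, fun _ => lfU_ne, fun _ => lfU_neg, fun _ _ => lfU_index h2,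
    fun _ _ _ => lfU_repr h2, hq⟩


section Forms

variable {K : Type} [Field K] {M M' M'' : Type} [AddCommGroup M] [Module K M]
  [AddCommGroup M'] [Module K M'] [AddCommGroup M''] [Module K M'']

theorem QIsom.symm' {Q : QuadraticForm K M} {Q' : QuadraticForm K M'} (h : QIsom Q Q') :
    QIsom Q' Q := by
  obtain ⟨φ, h⟩ := h
  exact ⟨φ.symm, fun x => by rw [← h, LinearEquiv.apply_symm_apply]⟩

theorem QIsom.trans' {Q : QuadraticForm K M} {Q' : QuadraticForm K M'} {Q'' : QuadraticForm K M''}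
    (h : QIsom Q Q') (h' : QIsom Q' Q'') : QIsom Q Q'' := by
  obtain ⟨φ, h⟩ := h
  obtain ⟨ψ, h'⟩ := h'
  exact ⟨φ.trans ψ, fun x => by rw [LinearEquiv.trans_apply, h', h]⟩

theorem QIsom.aniso {Q : QuadraticForm K M} {Q' : QuadraticForm K M'} (h : QIsom Q Q')
    (hQ : QuadraticMap.Anisotropic Q) : QuadraticMap.Anisotropic Q' := by
  obtain ⟨φ, h⟩ := h.symm'
  intro x hx
  have := hQ (φ x) (by rw [h, hx])
  simpa using this

/-- An injective form-preserving linear map between spaces of equal dimension is an isometry. -/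
theorem QIsom.of_inj [FiniteDimensional K M] [FiniteDimensional K M']
    {Q : QuadraticForm K M} {Q' : QuadraticForm K M'}
    (f : M →ₗ[K] M') (hd : Module.finrank K M = Module.finrank K M')
    (hf : ∀ x, f x = 0 → x = 0) (h : ∀ x, Q' (f x) = Q x) : QIsom Q Q' := by
  have hi : Function.Injective f := (injective_iff_map_eq_zero f).2 hf
  exact ⟨LinearEquiv.ofBijective f
    ⟨hi, (LinearMap.injective_iff_surjective_of_finrank_eq_finrank hd).1 hi⟩, fun x => h x⟩

theorem QIsom.of_aniso [FiniteDimensional K M] [FiniteDimensional K M']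
    {Q : QuadraticForm K M} {Q' : QuadraticForm K M'} (hQ : QuadraticMap.Anisotropic Q)
    (f : M →ₗ[K] M') (hd : Module.finrank K M = Module.finrank K M')
    (h : ∀ x, Q' (f x) = Q x) : QIsom Q Q' :=
  QIsom.of_inj f hd (fun x hx => hQ x (by rw [← h, hx, map_zero])) h

/-- The diagonal ternary form. -/
noncomputable def dg (a b c : K) : QuadraticForm K (K × K × K) :=
  (a • QuadraticMap.sq).prod ((b • QuadraticMap.sq).prod (c • QuadraticMap.sq))

theorem dg_apply (a b c : K) (x : K × K × K) :
    dg a b c x = a * (x.1 * x.1) + b * (x.2.1 * x.2.1) + c * (x.2.2 * x.2.2) := by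
  simp [dg, add_assoc]

theorem dg_ne {a b c : K} (h : QuadraticMap.Anisotropic (dg a b c)) : a ≠ 0 ∧ b ≠ 0 ∧ c ≠ 0 := by
  refine ⟨?_, ?_, ?_⟩ <;> rintro rfl
  · have := h (1, 0, 0) (by simp [dg_apply]); simp at this
  · have := h (0, 1, 0) (by simp [dg_apply]); simp at this
  · have := h (0, 0, 1) (by simp [dg_apply]); simp at this

theorem dg_perm1 {a b c : K} {u : QF K 3} (h : QIsom u (dg a b c)) : QIsom u (dg b a c) := by
  refine h.trans' ⟨
    { toFun := fun x => (x.2.1, x.1, x.2.2), invFun := fun x => (x.2.1, x.1, x.2.2),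
      map_add' := fun _ _ => rfl, map_smul' := fun _ _ => rfl,
      left_inv := fun _ => rfl, right_inv := fun _ => rfl }, fun x => ?_⟩
  simp [dg_apply]; ring

theorem dg_perm2 {a b c : K} {u : QF K 3} (h : QIsom u (dg a b c)) : QIsom u (dg a c b) := by
  refine h.trans' ⟨
    { toFun := fun x => (x.1, x.2.2, x.2.1), invFun := fun x => (x.1, x.2.2, x.2.1),
      map_add' := fun _ _ => rfl, map_smul' := fun _ _ => rfl,
      left_inv := fun _ => rfl, right_inv := fun _ => rfl }, fun x => ?_⟩
  simp [dg_apply]; ring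

theorem dg_scale {a b b' c z : K} {u : QF K 3} (hu : QuadraticMap.Anisotropic u)
    (h : QIsom u (dg a b c)) (hb : b = b' * (z * z)) : QIsom u (dg a b' c) := by
  refine h.trans' (QIsom.of_aniso (h.aniso hu)
    { toFun := fun x => (x.1, z * x.2.1, x.2.2)
      map_add' := fun x y => by simp [mul_add]
      map_smul' := fun r x => by simp; ring } rfl fun x => ?_)
  simp [dg_apply, hb]; ring

theorem dg_repr {t a b a' c r s : K} {u : QF K 3} (hu : QuadraticMap.Anisotropic u)
    (h : QIsom u (dg (t * a) (t * b) c)) (ha : a' ≠ 0) (hr : a * (r * r) + b * (s * s) = a') :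
    QIsom u (dg (t * a') (t * (a * b * a')) c) := by
  have h' := h.aniso hu
  obtain ⟨h1, h2, -⟩ := dg_ne h'
  have ha0 := right_ne_zero_of_mul h1
  have hb0 := right_ne_zero_of_mul h2
  refine h.trans' (QIsom.symm' (QIsom.of_inj
    { toFun := fun x => (r * x.1 - b * s * x.2.1, s * x.1 + a * r * x.2.1, x.2.2)
      map_add' := fun x y => by ext <;> simp <;> ring
      map_smul' := fun r x => by ext <;> simp <;> ring } rfl ?_ fun x => ?_))
  · rintro ⟨x, y, z⟩ hx
    simp only [LinearMap.coe_mk, AddHom.coe_mk, Prod.mk_eq_zero] at hx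
    obtain ⟨e1, e2, rfl⟩ := hx
    have hx : a' * x = 0 := by rw [← hr]; linear_combination a * r * e1 + b * s * e2
    have hy : a' * y = 0 := by rw [← hr]; linear_combination r * e2 - s * e1
    simp only [mul_eq_zero, ha, false_or] at hx hy
    simp [hx, hy]
  · simp [dg_apply, ← hr]; ring

theorem dg_exists (h2 : (2 : K) ≠ 0) (u : QF K 3) : ∃ a b c, QIsom u (dg a b c) := by
  have : Invertible (2 : K) := invertibleOfNonzero h2
  have h := QuadraticForm.equivalent_weightedSumSquares u
  rw [show Module.finrank K (Fin 3 → K) = 3 by simp] at h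
  obtain ⟨w, ⟨φ⟩⟩ := h
  refine ⟨w 0, w 1, w 2, QIsom.trans' ⟨φ.toLinearEquiv, φ.map_app⟩ (QIsom.of_inj
    { toFun := fun x => (x 0, x 1, x 2), map_add' := fun _ _ => rfl, map_smul' := fun _ _ => rfl }
    (by simp) ?_ fun x => ?_)⟩
  · intro x hx
    simp only [LinearMap.coe_mk, AddHom.coe_mk, Prod.mk_eq_zero] at hx
    ext i; fin_cases i <;> simp [hx]
  · simp [dg_apply, QuadraticMap.weightedSumSquares_apply, Fin.sum_univ_three]

theorem dg_nsq {t a b c : K} (h : QuadraticMap.Anisotropic (dg (t * a) (t * b) c)) :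
    ¬ IsSquare (-(a * b)) := by
  rintro ⟨z, hz⟩
  have hb := right_ne_zero_of_mul (dg_ne h).2.1
  have := h (b, z, 0) (by simp [dg_apply, ← hz]; ring)
  simp [hb] at this

theorem dg_classify {U : K → Prop} {q : K}
    (hneg : ∀ x, U x → U (-x))
    (hrep : ∀ x y z, U x → U y → U z → ∃ r s : K, x * (r * r) + y * (s * s) = z)
    (hq : ∀ x, x ≠ 0 → U x ∨ ∃ y, U y ∧ x = q * y)
    (h2 : (2 : K) ≠ 0) {u : QF K 3} (hu : QuadraticMap.Anisotropic u) :
    ∃ t t' a b c, ((t = 1 ∧ t' = q) ∨ (t = q ∧ t' = 1)) ∧ U a ∧ U b ∧ U c ∧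
      QIsom u (dg (t * a) (t * b) (t' * c)) := by
  obtain ⟨a, b, c, h⟩ := dg_exists h2 u
  obtain ⟨ha0, hb0, hc0⟩ := dg_ne (h.aniso hu)
  have hno : ∀ t a b c, U a → U b → U c → ¬ QIsom u (dg (t * a) (t * b) (t * c)) := by
    intro t a b c ha hb hc h
    obtain ⟨r, s, hrs⟩ := hrep a b (-c) ha hb (hneg c hc)
    have := (h.aniso hu) (r, s, 1) (by
      rw [dg_apply]; linear_combination t * hrs)
    simp at this
  rcases hq a ha0 with ha | ⟨a, ha, rfl⟩ <;> rcases hq b hb0 with hb | ⟨b, hb, rfl⟩ <;>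
    rcases hq c hc0 with hc | ⟨c, hc, rfl⟩
  · exact absurd (by simpa using h) (hno 1 a b c ha hb hc)
  · exact ⟨1, q, a, b, c, Or.inl ⟨rfl, rfl⟩, ha, hb, hc, by simpa using h⟩
  · exact ⟨1, q, a, c, b, Or.inl ⟨rfl, rfl⟩, ha, hc, hb, by simpa using dg_perm2 h⟩
  · exact ⟨q, 1, b, c, a, Or.inr ⟨rfl, rfl⟩, hb, hc, ha, by simpa using dg_perm2 (dg_perm1 h)⟩
  · exact ⟨1, q, b, c, a, Or.inl ⟨rfl, rfl⟩, hb, hc, ha, by simpa using dg_perm2 (dg_perm1 h)⟩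
  · exact ⟨q, 1, a, c, b, Or.inr ⟨rfl, rfl⟩, ha, hc, hb, by simpa using dg_perm2 h⟩
  · exact ⟨q, 1, a, b, c, Or.inr ⟨rfl, rfl⟩, ha, hb, hc, by simpa using h⟩
  · exact absurd (by simpa using h) (hno q a b c ha hb hc)

theorem dg_common {U : K → Prop} {q : K}
    (hmul : ∀ x y, U x → U y → U (x * y)) (hne : ∀ x, U x → x ≠ 0)
    (hneg : ∀ x, U x → U (-x))
    (hidx : ∀ x y, U x → U y → ¬ IsSquare x → ¬ IsSquare y → IsSquare (x * y))
    (hrep : ∀ x y z, U x → U y → U z → ∃ r s : K, x * (r * r) + y * (s * s) = z)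
    (hq : ∀ x, x ≠ 0 → U x ∨ ∃ y, U y ∧ x = q * y)
    (h2 : (2 : K) ≠ 0) {u v : QF K 3} (hu : QuadraticMap.Anisotropic u)
    (hv : QuadraticMap.Anisotropic v) :
    ∃ α β γ δ, QIsom u (dg α β γ) ∧ QIsom v (dg α β δ) := by
  obtain ⟨t, t', a, b, c, ht, ha, hb, hc, h⟩ := dg_classify hneg hrep hq h2 hu
  obtain ⟨s, s', a', b', c', hs, ha', hb', hc', h'⟩ := dg_classify hneg hrep hq h2 hv
  have hcase : (t = s) ∨ (t = s' ∧ s = t') := by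
    rcases ht with ⟨rfl, rfl⟩ | ⟨rfl, rfl⟩ <;> rcases hs with ⟨rfl, rfl⟩ | ⟨rfl, rfl⟩ <;> simp
  rcases hcase with rfl | ⟨rfl, rfl⟩
  · obtain ⟨r, s, hrs⟩ := hrep a b a' ha hb ha'
    have h1 := dg_repr hu h (hne _ ha') hrs
    obtain ⟨z, hz⟩ := hidx _ _ (hneg _ (hmul _ _ ha hb)) (hneg _ (hmul _ _ ha' hb'))
      (dg_nsq (h.aniso hu)) (dg_nsq (h'.aniso hv))
    have hb0 := hne _ hb'
    refine ⟨t * a', t * b', t' * c, s' * c', dg_scale hu h1 (z := z / b') ?_, h'⟩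
    field_simp
    linear_combination t * hz
  · obtain ⟨r, s, hrs⟩ := hrep a b c' ha hb hc'
    have h1 := dg_repr hu h (hne _ hc') hrs
    obtain ⟨r', s', hrs'⟩ := hrep a' b' c ha' hb' hc
    have h1' := dg_repr hv h' (hne _ hc) hrs'
    exact ⟨_, _, _, _, dg_perm2 h1, dg_perm1 (dg_perm2 h1')⟩

/-- The binary diagonal form. -/
noncomputable def bin (γ δ : K) : QF K 2 := QuadraticMap.weightedSumSquares K ![γ, δ]

theorem bin_apply (γ δ : K) (x : Fin 2 → K) :
    bin γ δ x = γ * (x 0 * x 0) + δ * (x 1 * x 1) := by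
  simp [bin, QuadraticMap.weightedSumSquares_apply, Fin.sum_univ_two]

theorem bin_aniso {γ δ : K} (hγ : γ ≠ 0) (h : ¬ ∃ z, δ = γ * (z * z)) :
    QuadraticMap.Anisotropic (bin γ (-δ)) := by
  intro x hx
  rw [bin_apply] at hx
  have h1 : x 1 = 0 := by
    by_contra h1
    refine h ⟨x 0 / x 1, ?_⟩
    field_simp
    linear_combination -hx
  have h0 : x 0 = 0 := by
    rw [h1] at hx
    have : γ * (x 0 * x 0) = 0 := by linear_combination hx
    simpa [hγ] using this
  ext i; fin_cases i <;> simp [h0, h1]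

theorem HypSum_apply (n : ℕ) (x : Fin n → K × K) :
    HypSum K n x = ∑ i, (x i).1 * (x i).2 := by
  simp [HypSum, HypForm, QuadraticMap.pi_apply]

theorem case_three (h2 : (2 : K) ≠ 0) {u v : QF K 3} (hu : QuadraticMap.Anisotropic u)
    (hv : QuadraticMap.Anisotropic v) (huv : ¬ QIsom u v) {α β γ δ : K}
    (h : QIsom u (dg α β γ)) (h' : QIsom v (dg α β δ)) :
    ∃ w : QF K 2, QuadraticMap.Anisotropic w ∧ WittEquiv w (u.prod (-v)) := by
  obtain ⟨hα, hβ, hγ⟩ := dg_ne (h.aniso hu)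
  refine ⟨bin γ (-δ), bin_aniso hγ ?_, 2, 0, ?_⟩
  · rintro ⟨z, hz⟩
    exact huv (h.trans' (dg_perm2 (dg_scale hv (dg_perm2 h') hz)).symm')
  · obtain ⟨φ, hφ⟩ := h.symm'
    obtain ⟨ψ, hψ⟩ := h'.symm'
    let f1 : (Fin 2 → K) × (Fin 2 → K × K) →ₗ[K] K × K × K :=
      { toFun := fun x => (((x.2 0).1 / α + (x.2 0).2) / 2, ((x.2 1).1 / β + (x.2 1).2) / 2, x.1 0)
        map_add' := fun x y => by ext <;> simp <;> ring
        map_smul' := fun r x => by ext <;> simp <;> ring }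
    let f2 : (Fin 2 → K) × (Fin 2 → K × K) →ₗ[K] K × K × K :=
      { toFun := fun x => (((x.2 0).2 - (x.2 0).1 / α) / 2, ((x.2 1).2 - (x.2 1).1 / β) / 2, x.1 1)
        map_add' := fun x y => by ext <;> simp <;> ring
        map_smul' := fun r x => by ext <;> simp <;> ring }
    refine QIsom.of_inj (((φ.toLinearMap.comp f1).prod (ψ.toLinearMap.comp f2)).prod 0)
      (by simp [Module.finrank_pi_fintype]) ?_ ?_
    · rintro ⟨x, y⟩ hx
      replace hx : ((φ (f1 (x, y)), ψ (f2 (x, y))), (0 : Fin 0 → K × K)) = 0 := hx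
      simp only [Prod.mk_eq_zero, LinearEquiv.map_eq_zero_iff, f1, f2, LinearMap.coe_mk,
        AddHom.coe_mk] at hx
      obtain ⟨⟨⟨e1, e2, e3⟩, ⟨g1, g2, g3⟩⟩, -⟩ := hx
      field_simp at e1 e2 g1 g2
      have k1 : 2 * α * (y 0).2 = 0 := by linear_combination e1 + g1
      have k2 : 2 * (y 0).1 = 0 := by linear_combination e1 - g1
      have k3 : 2 * β * (y 1).2 = 0 := by linear_combination e2 + g2
      have k4 : 2 * (y 1).1 = 0 := by linear_combination e2 - g2
      simp only [mul_eq_zero, h2, hα, hβ, false_or] at k1 k2 k3 k4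
      refine Prod.ext ?_ ?_
      · ext i; fin_cases i <;> simp [e3, g3]
      · ext i <;> fin_cases i <;> simp [k1, k2, k3, k4]
    · rintro ⟨x, y⟩
      change ((u.prod (-v)).prod (HypSum K 0))
        ((φ (f1 (x, y)), ψ (f2 (x, y))), (0 : Fin 0 → K × K)) = _
      simp only [QuadraticMap.prod_apply, neg_apply, hφ, hψ, HypSum_apply, dg_apply, bin_apply,
        f1, f2, LinearMap.coe_mk, AddHom.coe_mk, Fin.sum_univ_two]
      simp only [Finset.univ_eq_empty, Finset.sum_empty]
      field_simp
      ring

theorem case_one {u v : QF K 1} (hu : QuadraticMap.Anisotropic u)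
    (hv : QuadraticMap.Anisotropic v)
    (huv : ¬ QIsom u v) :
    ∃ w : QF K 2, QuadraticMap.Anisotropic w ∧ WittEquiv w (u.prod (-v)) := by
  have key : ∀ (u : QF K 1) (x : Fin 1 → K), u x = u 1 * (x 0 * x 0) := by
    intro u x
    have : x = x 0 • (1 : Fin 1 → K) := by ext i; fin_cases i; simp
    conv_lhs => rw [this, QuadraticMap.map_smul]
    simp; ring
  have hγ : u 1 ≠ 0 := fun h => one_ne_zero (hu 1 h)
  refine ⟨bin (u 1) (-(v 1)), bin_aniso hγ ?_, 0, 0, ?_⟩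
  · rintro ⟨z, hz⟩
    refine huv (QIsom.symm' (QIsom.of_aniso hv
      { toFun := fun x _ => z * x 0
        map_add' := fun x y => by ext; simp [mul_add]
        map_smul' := fun r x => by ext; simp; ring } rfl fun x => ?_))
    rw [key u, key v x, hz]
    simp; ring
  · refine QIsom.of_inj
      { toFun := fun x => ((fun _ => x.1 0, fun _ => x.1 1), 0)
        map_add' := fun x y => Prod.ext rfl (Subsingleton.elim _ _)
        map_smul' := fun r x => Prod.ext rfl (Subsingleton.elim _ _) } (by simp) ?_ ?_
    · rintro ⟨x, y⟩ hx
      simp only [LinearMap.coe_mk, AddHom.coe_mk, Prod.mk_eq_zero] at hx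
      obtain ⟨⟨h0, h1⟩, -⟩ := hx
      have h0 := congrFun h0 0
      have h1 := congrFun h1 0
      refine Prod.ext ?_ (Subsingleton.elim _ _)
      ext i; fin_cases i <;> simpa
    · rintro ⟨x, y⟩
      simp only [LinearMap.coe_mk, AddHom.coe_mk, QuadraticMap.prod_apply, neg_apply,
        HypSum_apply, bin_apply]
      rw [key u, key v]
      simp
end Forms

/-- If `u`, `v` are non-isometric anisotropic forms of common degree `m ∈ {1, 3}`, then
`u ⊥ (−v)` is Witt equivalent to an anisotropic form of degree `2`. -/
theorem statement_15 (p : ℕ) [Fact p.Prime] (hp : p ≠ 2) (K : Type) [Field K]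
    [Algebra ℚ_[p] K] [FiniteDimensional ℚ_[p] K]
    (m : ℕ) (hm : m = 1 ∨ m = 3) (u v : QF K m)
    (hu : QuadraticMap.Anisotropic u) (hv : QuadraticMap.Anisotropic v)
    (huv : ¬ QIsom u v) :
    ∃ w : QF K 2, QuadraticMap.Anisotropic w ∧ WittEquiv w (u.prod (-v)) := by
  obtain ⟨h2, U, q, hmul, hne, hneg, hidx, hrep, hq⟩ := lf_main p hp K
  rcases hm with rfl | rfl
  · exact case_one hu hv huv
  · obtain ⟨α, β, γ, δ, h, h'⟩ := dg_common hmul hne hneg hidx hrep hq h2 hu hv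
    exact case_three h2 hu hv huv h h'
end
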